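/- For every real ε with 0 < ε < 1/4, one has (1/√2)·∫₀^{2π} max(0, √(2ε) − √(1 − 2ε)·cos α) dα = 2√ε·(π − arccos √(ε/(1/2 − ε))) + 2·√(1/2 − 2ε). -/

import Mathlib

open MeasureTheory Real

theorem stmt_7 (ε : ℝ) (h1 : 0 < ε) (h2 : ε < 1/4) :
    (1/Real.sqrt 2) * ∫ α in (0:ℝ)..(2*Real.pi),
        max 0 (Real.sqrt (2*ε) - Real.sqrt (1 - 2*ε) * Real.cos α) =
      2 * Real.sqrt ε * (Real.pi - Real.arccos (Real.sqrt (ε/(1/2 - ε))))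
        + 2 * Real.sqrt (1/2 - 2*ε) := by
  have ha : Real.sqrt (2*ε) = Real.sqrt 2 * Real.sqrt ε := Real.sqrt_mul (by norm_num) _
  have hb : 0 < Real.sqrt (1 - 2*ε) := Real.sqrt_pos.mpr (by linarith)
  have hb2 : Real.sqrt (1 - 2*ε) ^ 2 = 1 - 2*ε := Real.sq_sqrt (by linarith)
  have hc : Real.sqrt (2*ε) = Real.sqrt (1 - 2*ε) * Real.sqrt (ε/(1/2 - ε)) := by
    rw [← Real.sqrt_mul (by linarith)]
    congr 1
    have : (1/2 - ε) ≠ 0 := by linarith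
    have h3 : ε / (1/2 - ε) * (1/2 - ε) = ε := div_mul_cancel₀ _ this
    linear_combination (-2) * h3
  have hc0 : 0 ≤ Real.sqrt (ε/(1/2 - ε)) := Real.sqrt_nonneg _
  have hc1 : Real.sqrt (ε/(1/2 - ε)) ≤ 1 := by
    rw [Real.sqrt_le_one, div_le_one (by linarith)]
    linarith
  have hs : Real.sqrt (1 - 2*ε) * Real.sin (Real.arccos (Real.sqrt (ε/(1/2 - ε))))
      = Real.sqrt 2 * Real.sqrt (1/2 - 2*ε) := by
    rw [Real.sin_arccos, Real.sq_sqrt (div_nonneg h1.le (by linarith)),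
      ← Real.sqrt_mul (by linarith), ← Real.sqrt_mul (by linarith)]
    congr 1
    have : (1/2 - ε) ≠ 0 := by linarith
    have h3 : ε / (1/2 - ε) * (1/2 - ε) = ε := div_mul_cancel₀ _ this
    linear_combination (-2) * h3
  have hcos := Real.cos_arccos (by linarith : -1 ≤ Real.sqrt (ε/(1/2 - ε))) hc1
  have t0 := Real.arccos_nonneg (Real.sqrt (ε/(1/2 - ε)))
  have t1 := Real.arccos_le_pi (Real.sqrt (ε/(1/2 - ε)))
  have h22 : Real.sqrt 2 * Real.sqrt 2 = 2 := Real.mul_self_sqrt (by norm_num)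
  have h20 : 0 < Real.sqrt 2 := by positivity
  generalize Real.sqrt (ε/(1/2 - ε)) = c at *
  generalize Real.arccos c = t at *
  generalize Real.sqrt (1 - 2*ε) = b at *
  have hint : ∀ u v : ℝ, IntervalIntegrable
      (fun α => max 0 (Real.sqrt (2*ε) - b * Real.cos α)) volume u v := fun u v =>
    Continuous.intervalIntegrable (by fun_prop) _ _
  have hA : ∫ α in (0:ℝ)..t, max 0 (Real.sqrt (2*ε) - b * Real.cos α) = 0 := by
    rw [intervalIntegral.integral_congr (g := fun _ => (0:ℝ))]
    · simp
    · intro x hx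
      rw [Set.uIcc_of_le t0] at hx
      have := Real.cos_le_cos_of_nonneg_of_le_pi hx.1 t1 hx.2
      refine max_eq_left ?_
      rw [hc]
      nlinarith
  have hC : ∫ α in (2*π - t)..(2*π), max 0 (Real.sqrt (2*ε) - b * Real.cos α) = 0 := by
    rw [intervalIntegral.integral_congr (g := fun _ => (0:ℝ))]
    · simp
    · intro x hx
      rw [Set.uIcc_of_le (by linarith)] at hx
      have := Real.cos_le_cos_of_nonneg_of_le_pi (x := 2*π - x) (by linarith [hx.2]) t1
        (by linarith [hx.1])
      rw [Real.cos_two_pi_sub] at this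
      refine max_eq_left ?_
      rw [hc]
      nlinarith
  have hB : ∫ α in t..(2*π - t), max 0 (Real.sqrt (2*ε) - b * Real.cos α)
      = Real.sqrt (2*ε) * (2*π - t - t) + 2 * (b * Real.sin t) := by
    rw [intervalIntegral.integral_congr (g := fun α => Real.sqrt (2*ε) - b * Real.cos α)]
    · rw [intervalIntegral.integral_sub (by simp)
        (Continuous.intervalIntegrable (by fun_prop) _ _),
        intervalIntegral.integral_const_mul, integral_cos, Real.sin_two_pi_sub]
      simp
      ring
    · intro x hx
      rw [Set.uIcc_of_le (by linarith)] at hx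
      have : Real.cos x ≤ Real.cos t := by
        rcases le_total x π with h | h
        · exact Real.cos_le_cos_of_nonneg_of_le_pi t0 h hx.1
        · rw [← Real.cos_two_pi_sub x]
          exact Real.cos_le_cos_of_nonneg_of_le_pi t0 (by linarith) (by linarith [hx.2])
      refine max_eq_right ?_
      rw [hc]
      nlinarith
  rw [← intervalIntegral.integral_add_adjacent_intervals (hint 0 t) (hint t (2*π)),
    ← intervalIntegral.integral_add_adjacent_intervals (hint t (2*π - t)) (hint _ (2*π)),
    hA, hB, hC, hs, ha]
  field_simp
  ring
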